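/- Let k be a field of characteristic zero, g ≥ 2 an even integer, F ∈ k[x] squarefree of degree 2g+1 or 2g+2, and K_F the associated hyperelliptic function field. Then every k-algebra automorphism u of K_F is represented by a unique pair (M, e) ∈ GL₂(k) × kˣ satisfying e = (det M)^{g/2}. Moreover, the assignment u ↦ M_u so defined is injective, satisfies M_{u∘v} = M_v · M_u for all automorphisms u, v (so that u ↦ M_u⁻¹ is an injective group homomorphism from the k-automorphism group of K_F into GL₂(k)), and the hyperelliptic involution w corresponds to M_w = −Id. -/

import Mathlib

open Polynomial

/-- Data exhibiting a field `K` (with a `k`-algebra structure) as the hyperelliptic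
function field `k(x)(y)` with `y² = F(x)`: elements `x, y ∈ K` with `x` transcendental
over `k`, `y² = F(x)`, and `K` generated as a field over `k` by `x` and `y`. -/
structure IsHyperellipticFunctionField (k : Type*) [Field k] (F : k[X])
    (K : Type*) [Field K] [Algebra k K] (x y : K) : Prop where
  transcendental_x : Transcendental k x
  sq : y ^ 2 = Polynomial.aeval x F
  adjoin_eq_top : IntermediateField.adjoin k ({x, y} : Set K) = ⊤

/-- The pair `(M, e)`, with `M = [[a,b],[c,d]] ∈ GL₂(k)` and `e ∈ kˣ`, represents the
`k`-algebra isomorphism `σ : K' → K` (where `K' = k(x')(y')` with `y'² = F'(x')` and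
`K = k(x)(y)` with `y² = F(x)`, both of genus `g`) if
`σ(x') = (a x + b)/(c x + d)` and `σ(y') = e y/(c x + d)^{g+1}`. -/
def Represents {k : Type*} [Field k] {K K' : Type*} [Field K] [Algebra k K]
    [Field K'] [Algebra k K'] (g : ℕ) (x y : K) (x' y' : K')
    (σ : K' ≃ₐ[k] K) (M : GL (Fin 2) k) (e : kˣ) : Prop :=
  σ x' = (algebraMap k K (M.val 0 0) * x + algebraMap k K (M.val 0 1)) /
      (algebraMap k K (M.val 1 0) * x + algebraMap k K (M.val 1 1)) ∧
  σ y' = algebraMap k K (e : k) * y /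
      (algebraMap k K (M.val 1 0) * x + algebraMap k K (M.val 1 1)) ^ (g + 1)

theorem IsDedekindDomain.exists_denominators_add_mul_eq_one {R K : Type*} [CommRing R]
    [IsDedekindDomain R] [Field K] [Algebra R K] [IsFractionRing R K] (a : K) :
    ∃ i j i' j' : R, algebraMap R K i' = a * algebraMap R K i ∧
      algebraMap R K j' = a * algebraMap R K j ∧ i + j' = 1 := by
  obtain ⟨n, d, hd, rfl⟩ := IsFractionRing.div_surjective (A := R) a
  have hd0 : d ≠ 0 := nonZeroDivisors.ne_zero hd
  have hdK : algebraMap R K d ≠ 0 := by simpa using hd0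
  obtain ⟨I, hI⟩ : Ideal.span {n, d} ∣ Ideal.span {d} :=
    Ideal.dvd_iff_le.2 (Ideal.span_mono (by simp))
  have quot : ∀ i ∈ I, ∃ i', n * i = d * i' := fun i hi ↦ by
    have : n * i ∈ Ideal.span {d} :=
      hI ▸ Ideal.mul_mem_mul (Ideal.subset_span (by simp)) hi
    exact Ideal.mem_span_singleton.1 this
  have hdmem : d ∈ Ideal.span {n} * I ⊔ Ideal.span {d} * I := by
    rw [← Ideal.sup_mul, ← Ideal.span_union, Set.singleton_union, ← hI]
    exact Ideal.mem_span_singleton_self d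
  obtain ⟨_, h₁, _, h₂, hsum⟩ := Submodule.mem_sup.1 hdmem
  obtain ⟨j, hj, rfl⟩ := Ideal.mem_span_singleton_mul.1 h₁
  obtain ⟨i, hi, rfl⟩ := Ideal.mem_span_singleton_mul.1 h₂
  obtain ⟨j', hj'⟩ := quot j hj
  obtain ⟨i', hi'⟩ := quot i hi
  refine ⟨i, j, i', j', ?_, ?_, ?_⟩
  · have := congrArg (algebraMap R K) hi'
    simp only [map_mul] at this
    field_simp
    linear_combination -this
  · have := congrArg (algebraMap R K) hj'
    simp only [map_mul] at this
    field_simp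
    linear_combination -this
  · apply mul_left_cancel₀ hd0
    linear_combination hsum - hj'

theorem Derivation.map_mem_valuationSubring {k R K : Type*} [Field k] [CommRing R]
    [IsDedekindDomain R] [Field K] [Algebra k K] [Algebra R K] [IsFractionRing R K]
    (D : Derivation k K K) (O : ValuationSubring K)
    (hD : ∀ r, D (algebraMap R K r) ∈ O) {a : K} (ha : a ∈ O) : D a ∈ O := by
  obtain ⟨i, j, i', j', hi, hj, hij⟩ :=
    IsDedekindDomain.exists_denominators_add_mul_eq_one (R := R) a
  have key : D a = algebraMap R K i * D a + algebraMap R K j' * D a := by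
    rw [← add_mul, ← map_add, hij, map_one, one_mul]
  have leib : ∀ b b' : R, algebraMap R K b' = a * algebraMap R K b →
      algebraMap R K b * D a ∈ O := fun b b' h ↦ by
    have h' := congrArg D h
    rw [D.leibniz, smul_eq_mul, smul_eq_mul] at h'
    have : algebraMap R K b * D a = D (algebraMap R K b') - a * D (algebraMap R K b) := by
      rw [h']; ring
    rw [this]
    exact sub_mem (hD _) (mul_mem ha (hD _))
  rw [key]
  refine add_mem (leib i i' hi) ?_
  rw [hj, mul_assoc]
  exact mul_mem ha (leib j j' hj)

/-- A derivation `D` of `K` plays the role of the dual of a differential `ω`; an element `f` is in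
`regularAt D O` when the differential `f ω` is regular along the valuation subring `O`, that is,
lies in the additive subgroup generated by the `a db` with `a, b ∈ O`. -/
def regularAt {k K : Type*} [Field k] [Field K] [Algebra k K] (D : Derivation k K K)
    (O : ValuationSubring K) : AddSubgroup K :=
  AddSubgroup.closure {z | ∃ a ∈ O, ∃ b ∈ O, z = a * D b}

section

variable {k K : Type*} [Field k] [Field K] [Algebra k K]

theorem mul_mem_regularAt (D : Derivation k K K) (O : ValuationSubring K) {a f : K} (ha : a ∈ O)
    (hf : f ∈ regularAt D O) : a * f ∈ regularAt D O := by
  induction hf using AddSubgroup.closure_induction with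
  | mem z hz =>
    obtain ⟨b, hb, c, hc, rfl⟩ := hz
    exact AddSubgroup.subset_closure ⟨a * b, mul_mem ha hb, c, hc, by ring⟩
  | zero => simp
  | add z z' _ _ h h' => rw [mul_add]; exact add_mem h h'
  | neg z _ h => rw [mul_neg]; exact neg_mem h

theorem mul_mem_of_mem_regularAt (D : Derivation k K K) (O : ValuationSubring K) {c f : K}
    (hD : ∀ a ∈ O, c * D a ∈ O) (hf : f ∈ regularAt D O) : c * f ∈ O := by
  induction hf using AddSubgroup.closure_induction with
  | mem z hz =>
    obtain ⟨b, hb, a, ha, rfl⟩ := hz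
    rw [mul_left_comm]
    exact mul_mem hb (hD a ha)
  | zero => simp
  | add z z' _ _ h h' => rw [mul_add]; exact add_mem h h'
  | neg z _ h => rw [mul_neg]; exact neg_mem h

theorem map_div_mem_regularAt (D : Derivation k K K) (O : ValuationSubring K) (u : K ≃ₐ[k] K)
    {h : K} (h0 : h ≠ 0) (hu : ∀ b, u (D b) = h * D (u b)) {f : K}
    (hf : f ∈ regularAt D (O.comap (u : K →+* K))) : u f / h ∈ regularAt D O := by
  induction hf using AddSubgroup.closure_induction with
  | mem z hz =>
    obtain ⟨a, ha, b, hb, rfl⟩ := hz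
    refine AddSubgroup.subset_closure ⟨u a, ha, u b, hb, ?_⟩
    rw [map_mul, hu]
    field_simp
  | zero => simp
  | add z z' _ _ h h' => rw [map_add, add_div]; exact add_mem h h'
  | neg z _ h => rw [map_neg, neg_div]; exact neg_mem h

theorem Derivation.ext_of_intermediateField_adjoin_eq_top {s : Set K}
    (hs : IntermediateField.adjoin k s = ⊤) {D E : Derivation k K K} (h : s.EqOn D E) :
    D = E := by
  ext a
  have ha : a ∈ IntermediateField.adjoin k s := hs ▸ IntermediateField.mem_top
  induction ha using IntermediateField.adjoin_induction with
  | mem z hz => exact h hz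
  | algebraMap z => simp
  | add z z' _ _ h h' => simp [h, h']
  | inv z _ h => simp [Derivation.leibniz_inv, h]
  | mul z z' _ _ h h' => simp [h, h']

/-- The conjugate of a derivation by an automorphism. -/
def Derivation.conj (u : K ≃ₐ[k] K) (D : Derivation k K K) : Derivation k K K :=
  Derivation.mk' (u.toLinearMap ∘ₗ D.toLinearMap ∘ₗ u.symm.toLinearMap) fun a b ↦ by
    simp

theorem Polynomial.exists_eq_mul_isCoprime (p q : k[X]) :
    ∃ d p' q' : k[X], p = d * p' ∧ q = d * q' ∧ IsCoprime p' q' := by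
  let := UniqueFactorizationMonoid.toGCDMonoid k[X]
  obtain ⟨p', q', hp, hq, h⟩ := extract_gcd p q
  exact ⟨_, p', q', hp, hq, (gcd_isUnit_iff p' q').1 h⟩

theorem dvd_of_sq_dvd_sq_mul_squarefree {F q r : k[X]} (hF : Squarefree F)
    (h : r ^ 2 ∣ q ^ 2 * F) : r ∣ q := by
  by_cases hr : r = 0
  · subst hr
    rw [zero_pow two_ne_zero, zero_dvd_iff, mul_eq_zero, or_iff_left hF.ne_zero] at h
    simp [pow_eq_zero_iff two_ne_zero |>.1 h]
  obtain ⟨d, r', q', rfl, rfl, hcop⟩ := Polynomial.exists_eq_mul_isCoprime r q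
  have hd : d ≠ 0 := left_ne_zero_of_mul hr
  have h' : r' ^ 2 ∣ q' ^ 2 * F := by
    apply (mul_dvd_mul_iff_left (pow_ne_zero 2 hd)).1
    convert h using 1 <;> ring
  have := (hcop.pow (m := 2) (n := 2)).dvd_of_dvd_mul_left h'
  exact mul_dvd_mul_left d ((hF r' (by rwa [← sq])).dvd)

theorem Transcendental.faithfulSMul_polynomial {x : K} (hx : Transcendental k x) [Algebra k[X] K]
    (h : algebraMap k[X] K = (Polynomial.aeval x : k[X] →ₐ[k] K)) : FaithfulSMul k[X] K := by
  rw [faithfulSMul_iff_algebraMap_injective, h]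
  exact transcendental_iff_injective.1 hx

theorem Polynomial.dvd_of_isIntegral_aeval_div {x : K} (hx : Transcendental k x)
    [Algebra k[X] K] [IsScalarTower k k[X] K]
    (h : algebraMap k[X] K = (aeval x : k[X] →ₐ[k] K)) {p r : k[X]} (hr : r ≠ 0)
    (hi : IsIntegral k[X] (aeval x p / aeval x r)) : r ∣ p := by
  have := hx.faithfulSMul_polynomial h
  let := FractionRing.liftAlgebra k[X] K
  have hi' : IsIntegral k[X] (algebraMap k[X] (FractionRing k[X]) p / algebraMap _ _ r) := by
    rw [← isIntegral_algebraMap_iff (algebraMap (FractionRing k[X]) K).injective, map_div₀,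
      ← IsScalarTower.algebraMap_apply, ← IsScalarTower.algebraMap_apply, h]
    exact hi
  obtain ⟨s, hs⟩ := IsIntegrallyClosed.algebraMap_eq_of_integral hi'
  refine ⟨s, IsFractionRing.injective k[X] (FractionRing k[X]) ?_⟩
  have : algebraMap k[X] (FractionRing k[X]) r ≠ 0 := by simpa using hr
  rw [map_mul, hs]
  field_simp

theorem ValuationSubring.aeval_mem (O : ValuationSubring K)
    (hO : ∀ c : k, algebraMap k K c ∈ O) {x : K} (hx : x ∈ O) (p : k[X]) : aeval x p ∈ O := by
  induction p using Polynomial.induction_on' with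
  | add p q hp hq => rw [map_add]; exact AddMemClass.add_mem hp hq
  | monomial n c => rw [aeval_monomial]; exact MulMemClass.mul_mem (hO c) (_root_.pow_mem hx n)

theorem ValuationSubring.two_inv_mem (O : ValuationSubring K)
    (hO : ∀ c : k, algebraMap k K c ∈ O) : (2⁻¹ : K) ∈ O := by
  simpa only [map_inv₀, map_ofNat] using hO 2⁻¹

theorem Polynomial.aeval_inv_mul_pow {x : K} (hx : x ≠ 0) {n : ℕ} {p : k[X]}
    (hp : p.natDegree ≤ n) : aeval x⁻¹ p * x ^ n = aeval x (reflect n p) := by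
  let := invertibleOfNonzero hx
  have := eval₂_reflect_mul_pow (algebraMap k K) x n (reflect n p)
    ((natDegree_reflect_le).trans (max_le le_rfl hp))
  rwa [reflect_reflect, invOf_eq_inv] at this

theorem Polynomial.squarefree_reflect {F : k[X]} (hF : Squarefree F) {N : ℕ} (hN : F.natDegree ≤ N)
    (hN' : N ≤ F.natDegree + 1) (h2 : 2 ≤ N) : Squarefree (reflect N F) := by
  intro q ⟨r, hr⟩
  have hG : reflect N F ≠ 0 := by rw [Ne, reflect_eq_zero_iff]; exact hF.ne_zero
  have hq0 : q ≠ 0 := by rintro rfl; simp [hr] at hG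
  have hr0 : r ≠ 0 := by rintro rfl; simp [hr] at hG
  have hdeg : q.natDegree + q.natDegree + r.natDegree ≤ N := by
    have h := natDegree_reflect_le (N := N) (p := F)
    rw [hr, natDegree_mul (mul_ne_zero hq0 hq0) hr0, natDegree_mul hq0 hq0, max_eq_left hN] at h
    exact h
  have hsplit : F = reflect q.natDegree q * reflect q.natDegree q *
      reflect (N - (q.natDegree + q.natDegree)) r := by
    rw [← reflect_mul q q le_rfl le_rfl, ← reflect_mul (q * q) r natDegree_mul_le (by omega), ← hr,
      Nat.add_sub_cancel' (by omega), reflect_reflect]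
  obtain ⟨c, hc, hcq⟩ := Polynomial.isUnit_iff.1 (hF _ ⟨_, hsplit⟩)
  have hq : q = C c * X ^ q.natDegree := by
    conv_lhs => rw [← reflect_reflect (N := q.natDegree) (p := q), ← hcq, reflect_C]
  by_cases hm : q.natDegree = 0
  · rw [hq, hm, pow_zero, mul_one]
    exact hc.map C
  · exfalso
    obtain ⟨m, hm⟩ := Nat.exists_eq_succ_of_ne_zero hm
    have hX : X ^ 2 ∣ reflect N F := by
      refine Dvd.dvd.trans ⟨C c * C c * X ^ (2 * m) * r, ?_⟩ dvd_rfl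
      rw [hr, hq, hm, Nat.succ_eq_add_one]
      ring
    rw [X_pow_dvd_iff] at hX
    have h0 := hX 0 (by norm_num)
    have h1 := hX 1 (by norm_num)
    rw [coeff_reflect, revAt_le (by omega)] at h0 h1
    have : F.natDegree = N - 0 ∨ F.natDegree = N - 1 := by omega
    have hlc : F.coeff F.natDegree ≠ 0 := by simpa using hF.ne_zero
    rcases this with h | h <;> rw [h] at hlc <;> contradiction

theorem Polynomial.exists_linear_fractional {x z f : K} (hx : Transcendental k x)
    (hz : Transcendental k z)
    (hf : f ≠ 0) {n : ℕ}
    (h : ∀ i ≤ n + 1, ∃ p : k[X], p.natDegree ≤ n + 1 ∧ z ^ i * f = aeval x p) :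
    ∃ (a b : k[X]) (c : k), a.natDegree ≤ 1 ∧ b.natDegree ≤ 1 ∧ aeval x b ≠ 0 ∧ c ≠ 0 ∧
      z * aeval x b = aeval x a ∧ f = algebraMap k K c * aeval x b ^ (n + 1) := by
  have hinj := transcendental_iff_injective.1 hx
  have hz0 : z ≠ 0 := by rintro rfl; exact hz isAlgebraic_zero
  obtain ⟨p₀, hd₀, hp₀⟩ := h 0 (by omega)
  obtain ⟨p₁, -, hp₁⟩ := h 1 (by omega)
  obtain ⟨p, hd, hp⟩ := h (n + 1) le_rfl
  rw [pow_zero, one_mul] at hp₀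
  rw [pow_one] at hp₁
  obtain ⟨d, b, a, rfl, rfl, hba⟩ := Polynomial.exists_eq_mul_isCoprime p₀ p₁
  have hdb : d * b ≠ 0 := by rintro h; rw [h, map_zero] at hp₀; exact hf hp₀
  have hda : d * a ≠ 0 := by
    rintro h
    rw [h, map_zero] at hp₁
    exact mul_ne_zero hz0 hf hp₁
  have hd0 := left_ne_zero_of_mul hdb
  have hb0 := right_ne_zero_of_mul hdb
  have ha0 := right_ne_zero_of_mul hda
  have key : p * (d * b) ^ n = (d * a) ^ (n + 1) := hinj <| by
    simp only [map_mul _ p, map_pow, ← hp, ← hp₀, ← hp₁]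
    ring
  have key' : p * b ^ n = d * a ^ (n + 1) := by
    apply mul_left_cancel₀ (pow_ne_zero n hd0)
    linear_combination key
  obtain ⟨c, rfl⟩ : b ^ n ∣ d := by
    apply (hba.pow (m := n) (n := n + 1)).dvd_of_dvd_mul_right
    exact ⟨p, by rw [← key', mul_comm]⟩
  have hpc : p = c * a ^ (n + 1) := by
    apply mul_right_cancel₀ (pow_ne_zero n hb0)
    linear_combination key'
  have hc0 := right_ne_zero_of_mul hd0
  rw [hpc, natDegree_mul hc0 (pow_ne_zero _ ha0), natDegree_pow] at hd
  rw [natDegree_mul hd0 hb0, natDegree_mul (pow_ne_zero _ hb0) hc0, natDegree_pow] at hd₀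
  have hB : aeval x b ≠ 0 := fun h ↦ hb0 (hinj (by rw [h, map_zero]))
  have hzb : z * aeval x b = aeval x a := by
    apply mul_right_cancel₀ hf
    rw [map_mul _ (b ^ n * c) b] at hp₀
    rw [map_mul _ (b ^ n * c) a] at hp₁
    linear_combination aeval x b * hp₁ - aeval x a * hp₀
  have hadeg : a.natDegree ≤ 1 := by nlinarith
  have hbdeg : b.natDegree ≤ 1 := by nlinarith
  have hcdeg : c.natDegree = 0 := by
    by_contra hc
    have ha : a.natDegree = 0 := by
      by_contra ha
      have : a.natDegree = 1 := by omega
      rw [this] at hd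
      omega
    have hb : b.natDegree = 0 := by
      by_contra hb
      have : b.natDegree = 1 := by omega
      rw [this] at hd₀
      omega
    rw [eq_C_of_natDegree_eq_zero ha, eq_C_of_natDegree_eq_zero hb] at hzb
    rw [eq_C_of_natDegree_eq_zero hb] at hB
    simp only [aeval_C] at hzb hB
    apply hz
    rw [eq_div_of_mul_eq hB hzb, ← map_div₀]
    exact isAlgebraic_algebraMap _
  refine ⟨a, b, c.coeff 0, hadeg, hbdeg, hB, ?_, hzb, ?_⟩
  · rw [eq_C_of_natDegree_eq_zero hcdeg] at hc0
    simpa using hc0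
  · rw [hp₀, ← aeval_C (A := K) x, ← eq_C_of_natDegree_eq_zero hcdeg]
    simp only [map_mul, map_pow]
    ring

end

section

variable {k K : Type*} [Field k] [Field K] [Algebra k K] {F : k[X]} {x y : K}

namespace IsHyperellipticFunctionField

theorem aeval_ne_zero (hK : IsHyperellipticFunctionField k F K x y) {p : k[X]} (hp : p ≠ 0) :
    aeval x p ≠ 0 :=
  fun h ↦ hp ((transcendental_iff.1 hK.transcendental_x) p h)

theorem y_ne_zero (hK : IsHyperellipticFunctionField k F K x y) (hF : Squarefree F) : y ≠ 0 := by
  rintro rfl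
  exact hK.aeval_ne_zero hF.ne_zero (by rw [← hK.sq]; simp)

theorem algEquiv_ext (hK : IsHyperellipticFunctionField k F K x y) {u v : K ≃ₐ[k] K}
    (hx : u x = v x) (hy : u y = v y) : u = v := by
  have : (u : K →ₐ[k] K).comp (IntermediateField.val _) =
      (v : K →ₐ[k] K).comp (IntermediateField.val _) :=
    IntermediateField.algHom_ext_of_eq_adjoin k hK.adjoin_eq_top.symm (by
      rintro z (rfl | rfl)
      exacts [hx, hy])
  ext z
  exact DFunLike.congr_fun this ⟨z, IntermediateField.mem_top⟩

theorem exists_eq_div [CharZero k] (hK : IsHyperellipticFunctionField k F K x y) (f : K) :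
    ∃ p q r : k[X], r ≠ 0 ∧ f = (aeval x p + aeval x q * y) / aeval x r := by
  have hf : f ∈ IntermediateField.adjoin k {x, y} := hK.adjoin_eq_top ▸ IntermediateField.mem_top
  have : CharZero K := charZero_of_injective_algebraMap (algebraMap k K).injective
  induction hf using IntermediateField.adjoin_induction with
  | mem z hz =>
    obtain rfl | rfl := hz
    · exact ⟨X, 0, 1, one_ne_zero, by simp⟩
    · exact ⟨0, 1, 1, one_ne_zero, by simp⟩
  | algebraMap c => exact ⟨C c, 0, 1, one_ne_zero, by simp⟩
  | add z z' _ _ h h' =>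
    obtain ⟨p, q, r, hr, rfl⟩ := h
    obtain ⟨p', q', r', hr', rfl⟩ := h'
    refine ⟨p * r' + p' * r, q * r' + q' * r, r * r', mul_ne_zero hr hr', ?_⟩
    have := hK.aeval_ne_zero hr
    have := hK.aeval_ne_zero hr'
    simp only [map_add, map_mul]
    field_simp
    ring
  | mul z z' _ _ h h' =>
    obtain ⟨p, q, r, hr, rfl⟩ := h
    obtain ⟨p', q', r', hr', rfl⟩ := h'
    refine ⟨p * p' + q * q' * F, p * q' + p' * q, r * r', mul_ne_zero hr hr', ?_⟩
    have := hK.aeval_ne_zero hr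
    have := hK.aeval_ne_zero hr'
    simp only [map_add, map_mul, ← hK.sq]
    field_simp
    ring
  | inv z _ h =>
    obtain ⟨p, q, r, hr, rfl⟩ := h
    have hr0 := hK.aeval_ne_zero hr
    by_cases hn : p ^ 2 - q ^ 2 * F = 0
    · have hn' : (aeval x p + aeval x q * y) * (aeval x p - aeval x q * y) = 0 := by
        have := congrArg (aeval x) hn
        simp only [map_sub, map_pow, map_mul, map_zero, ← hK.sq] at this
        linear_combination this
      rcases mul_eq_zero.1 hn' with h | h
      · exact ⟨0, 0, 1, one_ne_zero, by simp [h]⟩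
      · by_cases hp : p = 0
        · refine ⟨0, 0, 1, one_ne_zero, ?_⟩
          rw [hp, map_zero, zero_sub, neg_eq_zero] at h
          simp [hp, h]
        · refine ⟨r, 0, 2 * p, mul_ne_zero two_ne_zero hp, ?_⟩
          have : aeval x p + aeval x q * y = 2 * aeval x p := by linear_combination -h
          rw [this]
          rw [map_mul, map_ofNat]
          simp
    · refine ⟨r * p, -(r * q), p ^ 2 - q ^ 2 * F, hn, ?_⟩
      have hn0 := hK.aeval_ne_zero hn
      have hfac : aeval x (p ^ 2 - q ^ 2 * F) =
          (aeval x p + aeval x q * y) * (aeval x p - aeval x q * y) := by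
        simp only [map_sub, map_pow, map_mul, ← hK.sq]
        ring
      rw [hfac] at hn0 ⊢
      have h₁ := left_ne_zero_of_mul hn0
      have h₂ := right_ne_zero_of_mul hn0
      simp only [map_neg, map_mul]
      field_simp
      ring

theorem exists_eq_of_isIntegral [CharZero k] (hK : IsHyperellipticFunctionField k F K x y)
    (hF : Squarefree F) [Algebra k[X] K] [IsScalarTower k k[X] K]
    (h : algebraMap k[X] K = (aeval x : k[X] →ₐ[k] K)) (w : K ≃ₐ[k] K) (hwx : w x = x)
    (hwy : w y = -y) {f : K} (hf : IsIntegral k[X] f) :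
    ∃ p q : k[X], f = aeval x p + aeval x q * y := by
  have : CharZero K := charZero_of_injective_algebraMap (algebraMap k K).injective
  have hw : ∀ p : k[X], w (aeval x p) = aeval x p := fun p ↦ by
    rw [← aeval_algHom_apply, hwx]
  obtain ⟨p, q, r, hr, rfl⟩ := hK.exists_eq_div f
  have hr0 := hK.aeval_ne_zero hr
  have hwf : IsIntegral k[X] ((aeval x p - aeval x q * y) / aeval x r) := by
    let W : K →ₐ[k[X]] K := { (w : K →+* K) with
      commutes' := fun p ↦ by
        rw [h]
        exact hw p }
    have : W ((aeval x p + aeval x q * y) / aeval x r) =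
        (aeval x p - aeval x q * y) / aeval x r := by
      change w _ = _
      simp only [map_div₀, map_add, map_mul, hw, hwy]
      ring
    rw [← this]
    exact hf.map W
  have hp : r ∣ 2 * p := by
    refine Polynomial.dvd_of_isIntegral_aeval_div hK.transcendental_x h hr ?_
    have e : aeval x (2 * p) / aeval x r = (aeval x p + aeval x q * y) / aeval x r +
        (aeval x p - aeval x q * y) / aeval x r := by
      rw [map_mul, map_ofNat]
      ring
    rw [e]
    exact hf.add hwf
  have hq : r ^ 2 ∣ (2 * q) ^ 2 * F := by
    refine Polynomial.dvd_of_isIntegral_aeval_div hK.transcendental_x h (pow_ne_zero 2 hr) ?_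
    have e : aeval x ((2 * q) ^ 2 * F) / aeval x (r ^ 2) =
        ((aeval x p + aeval x q * y) / aeval x r -
          (aeval x p - aeval x q * y) / aeval x r) ^ 2 := by
      simp only [map_mul, map_pow, map_ofNat, ← hK.sq]
      ring
    rw [e]
    exact (hf.sub hwf).pow 2
  obtain ⟨p', hp'⟩ := hp
  obtain ⟨q', hq'⟩ := dvd_of_sq_dvd_sq_mul_squarefree hF hq
  refine ⟨C 2⁻¹ * p', C 2⁻¹ * q', ?_⟩
  have e₁ := congrArg (aeval x) hp'
  have e₂ := congrArg (aeval x) hq'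
  simp only [map_mul, map_ofNat, aeval_C, map_inv₀] at e₁ e₂ ⊢
  field_simp
  linear_combination e₁ + y * e₂

theorem finiteDimensional [CharZero k] (hK : IsHyperellipticFunctionField k F K x y)
    [Algebra k[X] K] [Algebra (FractionRing k[X]) K] [IsScalarTower k[X] (FractionRing k[X]) K]
    (h : algebraMap k[X] K = (aeval x : k[X] →ₐ[k] K)) :
    FiniteDimensional (FractionRing k[X]) K := by
  refine Module.finite_def.2 (Submodule.fg_def.2 ⟨{1, y}, Set.toFinite _, ?_⟩)
  rw [eq_top_iff]
  rintro f -
  obtain ⟨p, q, r, -, rfl⟩ := hK.exists_eq_div f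
  rw [Submodule.mem_span_pair]
  refine ⟨algebraMap _ _ p / algebraMap _ _ r, algebraMap _ _ q / algebraMap _ _ r, ?_⟩
  simp only [Algebra.smul_def, map_div₀, ← IsScalarTower.algebraMap_apply, h]
  simp
  ring

theorem exists_derivation [CharZero k] (hK : IsHyperellipticFunctionField k F K x y) (c : K) :
    ∃ D : Derivation k K K, D x = c := by
  let : Algebra k[X] K := (aeval x : k[X] →ₐ[k] K).toAlgebra
  have h : algebraMap k[X] K = (aeval x : k[X] →ₐ[k] K) := rfl
  have : IsScalarTower k k[X] K := .of_algebraMap_eq fun a ↦ by simp [h]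
  have := hK.transcendental_x.faithfulSMul_polynomial h
  let := FractionRing.liftAlgebra k[X] K
  have := hK.finiteDimensional h
  have : CharZero (FractionRing k[X]) :=
    charZero_of_injective_algebraMap (IsFractionRing.injective k[X] (FractionRing k[X]))
  have : Algebra.FormallyEtale (FractionRing k[X]) K := .of_isSeparable _ _
  have : Algebra.FormallyEtale k[X] (FractionRing k[X]) := .of_isLocalization (nonZeroDivisors k[X])
  have : Algebra.FormallyEtale k[X] K := .comp k[X] (FractionRing k[X]) K
  let e := KaehlerDifferential.tensorKaehlerEquivOfFormallyEtale k k[X] K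
  let l : TensorProduct k[X] K (Ω[k[X]⁄k]) →ₗ[K] K :=
    ((Algebra.linearMap k[X] K).comp
      (KaehlerDifferential.polynomialEquiv k).toLinearMap).liftBaseChange K
  refine ⟨c • (l.comp e.symm.toLinearMap).compDer (KaehlerDifferential.D k K), ?_⟩
  have hx : e.symm (KaehlerDifferential.D k K x) =
      TensorProduct.tmul k[X] 1 (KaehlerDifferential.D k k[X] X) := by
    have := KaehlerDifferential.tensorKaehlerEquivOfFormallyEtale_symm_D_algebraMap k k[X] K X
    simpa [h] using this
  simp [hx, l]

theorem two_mul_map_y (hK : IsHyperellipticFunctionField k F K x y) (D : Derivation k K K) :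
    2 * y * D y = aeval x (derivative F) * D x := by
  have := congrArg D hK.sq
  rw [Derivation.map_aeval, pow_two, D.leibniz] at this
  simp only [smul_eq_mul] at this
  linear_combination this

theorem derivation_ext [CharZero k] (hK : IsHyperellipticFunctionField k F K x y)
    (hF : Squarefree F)
    {D E : Derivation k K K} (h : D x = E x) : D = E := by
  have : CharZero K := charZero_of_injective_algebraMap (algebraMap k K).injective
  refine Derivation.ext_of_intermediateField_adjoin_eq_top hK.adjoin_eq_top ?_
  rintro z (rfl | rfl)
  · exact h
  · have h2y : 2 * z ≠ 0 := mul_ne_zero two_ne_zero (hK.y_ne_zero hF)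
    exact mul_left_cancel₀ h2y (by rw [hK.two_mul_map_y, hK.two_mul_map_y, h])

theorem two_mul_map_y_of_map_x [CharZero k] (hK : IsHyperellipticFunctionField k F K x y)
    (hF : Squarefree F) {D : Derivation k K K} (hD : D x = y) :
    2 * D y = aeval x (derivative F) := by
  have := hK.two_mul_map_y D
  rw [hD] at this
  exact mul_left_cancel₀ (hK.y_ne_zero hF) (by linear_combination this)

theorem y_mem (hK : IsHyperellipticFunctionField k F K x y) {O : ValuationSubring K}
    (hO : ∀ c : k, algebraMap k K c ∈ O) (hx : x ∈ O) : y ∈ O := by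
  by_contra hy
  have hy' : y⁻¹ ∈ O := (O.mem_or_inv_mem y).resolve_left hy
  have hy0 : y ≠ 0 := fun h ↦ hy (h ▸ O.zero_mem)
  apply hy
  have : y = y⁻¹ * aeval x F := by rw [← hK.sq]; field_simp
  rw [this]
  exact mul_mem hy' (O.aeval_mem hO hx F)

theorem derivation_map_mem [CharZero k] (hK : IsHyperellipticFunctionField k F K x y)
    (hF : Squarefree F) (w : K ≃ₐ[k] K) (hwx : w x = x) (hwy : w y = -y)
    {D : Derivation k K K} (hD : D x = y) {O : ValuationSubring K}
    (hO : ∀ c : k, algebraMap k K c ∈ O) (hx : x ∈ O) {a : K} (ha : a ∈ O) : D a ∈ O := by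
  have : CharZero K := charZero_of_injective_algebraMap (algebraMap k K).injective
  let : Algebra k[X] K := (aeval x : k[X] →ₐ[k] K).toAlgebra
  have h : algebraMap k[X] K = (aeval x : k[X] →ₐ[k] K) := rfl
  have : IsScalarTower k k[X] K := .of_algebraMap_eq fun a ↦ by simp [h]
  have := hK.transcendental_x.faithfulSMul_polynomial h
  let := FractionRing.liftAlgebra k[X] K
  have := hK.finiteDimensional h
  have : CharZero (FractionRing k[X]) :=
    charZero_of_injective_algebraMap (IsFractionRing.injective k[X] (FractionRing k[X]))
  have : IsFractionRing (integralClosure k[X] K) K :=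
    integralClosure.isFractionRing_of_finite_extension (FractionRing k[X]) K
  refine D.map_mem_valuationSubring (R := integralClosure k[X] K) O (fun r ↦ ?_) ha
  obtain ⟨p, q, hr⟩ := hK.exists_eq_of_isIntegral hF h w hwx hwy r.2
  have hy := hK.y_mem hO hx
  have hDy : D y = 2⁻¹ * aeval x (derivative F) := by
    rw [← hK.two_mul_map_y_of_map_x hF hD]; field_simp
  change D (r : K) ∈ O
  rw [hr, map_add, D.leibniz, Derivation.map_aeval, Derivation.map_aeval, hD, hDy]
  have := fun p ↦ O.aeval_mem hO hx p
  exact add_mem (mul_mem (this _) hy) (add_mem (mul_mem (this _)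
    (mul_mem (O.two_inv_mem hO) (this _))) (mul_mem hy (mul_mem (this _) hy)))

theorem exists_eq_of_forall_mem [CharZero k] (hK : IsHyperellipticFunctionField k F K x y)
    (hF : Squarefree F) (w : K ≃ₐ[k] K) (hwx : w x = x) (hwy : w y = -y) {f : K}
    (hf : ∀ O : ValuationSubring K, (∀ c : k, algebraMap k K c ∈ O) → x ∈ O → f ∈ O) :
    ∃ p q : k[X], f = aeval x p + aeval x q * y := by
  let : Algebra k[X] K := (aeval x : k[X] →ₐ[k] K).toAlgebra
  have h : algebraMap k[X] K = (aeval x : k[X] →ₐ[k] K) := rfl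
  have : IsScalarTower k k[X] K := .of_algebraMap_eq fun a ↦ by simp [h]
  refine hK.exists_eq_of_isIntegral hF h w hwx hwy ?_
  have hmem : f ∈
      (integralClosure (Subring.closure (Set.range (algebraMap k[X] K))) K).toSubring := by
    rw [← iInf_valuationSubring_superset]
    refine (Subring.mem_iInf).2 fun V ↦
      hf V.1 (fun c ↦ V.2 ⟨C c, by simp [h]⟩) (V.2 ⟨X, by simp [h]⟩)
  have hint : IsIntegral (Subring.closure (Set.range (algebraMap k[X] K))) f := hmem
  have hle : Subring.closure (Set.range (algebraMap k[X] K)) ≤ (algebraMap k[X] K).range :=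
    Subring.closure_le.2 fun _ h ↦ h
  obtain ⟨P, hP, hPf⟩ := hint
  have hlift : P.map (Subring.closure (Set.range (algebraMap k[X] K))).subtype ∈
      Polynomial.lifts (algebraMap k[X] K) := by
    rw [Polynomial.lifts_iff_coeff_lifts]
    intro n
    rw [coeff_map]
    exact hle (P.coeff n).2
  obtain ⟨Q, hQ, -, hQm⟩ := Polynomial.lifts_and_degree_eq_and_monic hlift (hP.map _)
  refine ⟨Q, hQm, ?_⟩
  rw [← eval_map, hQ, eval_map]
  exact hPf

theorem one_mem_regularAt [CharZero k] (hK : IsHyperellipticFunctionField k F K x y)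
    (hF : Squarefree F) {D : Derivation k K K} (hD : D x = y) {O : ValuationSubring K}
    (hO : ∀ c : k, algebraMap k K c ∈ O) (hx : x ∈ O) : 1 ∈ regularAt D O := by
  obtain ⟨A, B, hAB⟩ := PerfectField.separable_iff_squarefree.2 hF
  have hy := hK.y_mem hO hx
  have e : (1 : K) = aeval x A * y * D x + 2 * aeval x B * D y := by
    have := congrArg (aeval x) hAB
    simp only [map_add, map_mul, map_one, ← hK.sq, ← hK.two_mul_map_y_of_map_x hF hD] at this
    rw [hD]
    linear_combination -this
  rw [e]
  have := fun p ↦ O.aeval_mem hO hx p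
  refine add_mem (AddSubgroup.subset_closure ⟨_, mul_mem (this A) hy, x, hx, rfl⟩)
    (AddSubgroup.subset_closure ⟨_, mul_mem ?_ (this B), y, hy, rfl⟩)
  exact ofNat_mem O 2

theorem x_ne_zero (hK : IsHyperellipticFunctionField k F K x y) : x ≠ 0 := by
  simpa using hK.aeval_ne_zero X_ne_zero

/-- The model of a hyperelliptic function field in the chart at infinity. -/
theorem atInfinity {g : ℕ} (hK : IsHyperellipticFunctionField k F K x y)
    (hF : F.natDegree ≤ 2 * g + 2) :
    IsHyperellipticFunctionField k (reflect (2 * g + 2) F) K x⁻¹ (y * x⁻¹ ^ (g + 1)) where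
  transcendental_x := by
    have := hK.transcendental_x
    contrapose! this
    simpa [Transcendental] using (not_not.1 this).inv
  sq := by
    have hx := hK.x_ne_zero
    have := aeval_inv_mul_pow (x := x⁻¹) (inv_ne_zero hx) hF
    rw [← this, inv_inv, ← hK.sq]
    ring
  adjoin_eq_top := by
    rw [eq_top_iff, ← hK.adjoin_eq_top, IntermediateField.adjoin_le_iff]
    have hx : x ∈ IntermediateField.adjoin k {x⁻¹, y * x⁻¹ ^ (g + 1)} := by
      rw [← inv_inv x]
      exact inv_mem (IntermediateField.subset_adjoin _ _ (by simp))
    rintro z (rfl | rfl)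
    · exact hx
    · have hz := mul_mem (IntermediateField.subset_adjoin k {x⁻¹, z * x⁻¹ ^ (g + 1)}
        (Set.mem_insert_of_mem _ rfl)) (pow_mem hx (g + 1))
      have e : z * x⁻¹ ^ (g + 1) * x ^ (g + 1) = z := by
        rw [mul_assoc, ← mul_pow, inv_mul_cancel₀ hK.x_ne_zero, one_pow, mul_one]
      rwa [e] at hz

theorem eq_zero_of_add_mul_eq_zero [CharZero k] (hK : IsHyperellipticFunctionField k F K x y)
    (hF : Squarefree F) (w : K ≃ₐ[k] K) (hwx : w x = x) (hwy : w y = -y) {p q : k[X]}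
    (h : aeval x p + aeval x q * y = 0) : p = 0 ∧ q = 0 := by
  have : CharZero K := charZero_of_injective_algebraMap (algebraMap k K).injective
  have hw : ∀ p : k[X], w (aeval x p) = aeval x p := fun p ↦ by
    rw [← aeval_algHom_apply, hwx]
  have h' := congrArg w h
  simp only [map_add, map_mul, hw, hwy, map_zero] at h'
  have hp : 2 * aeval x p = 0 := by linear_combination h + h'
  have hp' : aeval x p = 0 := by simpa using hp
  have hq : aeval x q = 0 := by simpa [hp', hK.y_ne_zero hF] using h
  exact ⟨by_contra fun h ↦ hK.aeval_ne_zero h hp', by_contra fun h ↦ hK.aeval_ne_zero h hq⟩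

theorem smul_derivation_inv {g : ℕ} (hg : 1 ≤ g) {D : Derivation k K K}
    (hD : D x = y) : (-(x⁻¹ ^ (g - 1)) • D) x⁻¹ = y * x⁻¹ ^ (g + 1) := by
  obtain ⟨n, rfl⟩ := Nat.exists_eq_add_of_le' hg
  simp only [Derivation.smul_apply, Derivation.leibniz_inv, hD, smul_eq_mul, Nat.add_sub_cancel]
  ring

theorem pow_mem_regularAt [CharZero k] {g : ℕ} (hg : 1 ≤ g)
    (hK : IsHyperellipticFunctionField k F K x y) (hF : Squarefree F)
    (hdF : F.natDegree = 2 * g + 1 ∨ F.natDegree = 2 * g + 2) {D : Derivation k K K}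
    (hD : D x = y) {O : ValuationSubring K} (hO : ∀ c : k, algebraMap k K c ∈ O) {i : ℕ}
    (hi : i ≤ g - 1) : x ^ i ∈ regularAt D O := by
  by_cases hx : x ∈ O
  · simpa using mul_mem_regularAt D O (pow_mem hx i) (hK.one_mem_regularAt hF hD hO hx)
  have hx0 := hK.x_ne_zero
  have hs : x⁻¹ ∈ O := (O.mem_or_inv_mem x).resolve_left hx
  have h1 := (hK.atInfinity (g := g) (by omega)).one_mem_regularAt
    (squarefree_reflect hF (by omega) (by omega) (by omega)) (smul_derivation_inv hg hD) hO hs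
  have h2 : ∀ f ∈ regularAt (-(x⁻¹ ^ (g - 1)) • D) O, x ^ (g - 1) * f ∈ regularAt D O := by
    intro f hf
    induction hf using AddSubgroup.closure_induction with
    | mem z hz =>
      obtain ⟨a, ha, b, hb, rfl⟩ := hz
      refine AddSubgroup.subset_closure ⟨-a, neg_mem ha, b, hb, ?_⟩
      simp
      field_simp
    | zero => simp
    | add z z' _ _ h h' => rw [mul_add]; exact add_mem h h'
    | neg z _ h => rw [mul_neg]; exact neg_mem h
  have h3 := mul_mem_regularAt D O (pow_mem hs (g - 1 - i)) (h2 1 h1)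
  have e : x ^ i = x⁻¹ ^ (g - 1 - i) * (x ^ (g - 1) * 1) := by
    rw [mul_one, inv_pow, ← Nat.sub_add_cancel hi, Nat.add_sub_cancel, pow_add]
    field_simp
  rwa [e]

theorem exists_polynomial_of_forall_mem_regularAt [CharZero k] {g : ℕ} (hg : 1 ≤ g)
    (hK : IsHyperellipticFunctionField k F K x y) (hF : Squarefree F)
    (hdF : F.natDegree = 2 * g + 1 ∨ F.natDegree = 2 * g + 2) (w : K ≃ₐ[k] K) (hwx : w x = x)
    (hwy : w y = -y) {D : Derivation k K K} (hD : D x = y) {f : K}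
    (hf : ∀ O : ValuationSubring K, (∀ c : k, algebraMap k K c ∈ O) → f ∈ regularAt D O) :
    ∃ p : k[X], p.natDegree ≤ g - 1 ∧ f = aeval x p := by
  have hx0 := hK.x_ne_zero
  have hwx' : w x⁻¹ = x⁻¹ := by rw [map_inv₀, hwx]
  have hwy' : w (y * x⁻¹ ^ (g + 1)) = -(y * x⁻¹ ^ (g + 1)) := by
    rw [map_mul, map_pow, hwx', hwy, neg_mul]
  have hK' := hK.atInfinity (g := g) (by omega)
  have hF' := squarefree_reflect hF (N := 2 * g + 2) (by omega) (by omega) (by omega)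
  have hD' := smul_derivation_inv hg hD
  obtain ⟨p, q, hpq⟩ := hK.exists_eq_of_forall_mem hF w hwx hwy (f := f) fun O hO hx ↦ by
    rw [← one_mul f]
    refine mul_mem_of_mem_regularAt D O (fun a ha ↦ ?_) (hf O hO)
    rw [one_mul]
    exact hK.derivation_map_mem hF w hwx hwy hD hO hx ha
  obtain ⟨P, Q, hPQ⟩ := hK'.exists_eq_of_forall_mem hF' w hwx' hwy' (f := -(x⁻¹ ^ (g - 1)) * f)
    fun O hO hx ↦ mul_mem_of_mem_regularAt D O
      (fun a ha ↦ hK'.derivation_map_mem hF' w hwx' hwy' hD' hO hx ha) (hf O hO)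
  set n := max P.natDegree Q.natDegree
  have hP := aeval_inv_mul_pow hx0 (le_max_left P.natDegree Q.natDegree)
  have hQ := aeval_inv_mul_pow hx0 (le_max_right P.natDegree Q.natDegree)
  have hPd : (reflect n P).natDegree ≤ n :=
    natDegree_reflect_le.trans (max_le le_rfl (le_max_left _ _))
  have hQd : (reflect n Q).natDegree ≤ n :=
    natDegree_reflect_le.trans (max_le le_rfl (le_max_right _ _))
  change _ * x ^ n = aeval x (reflect n P) at hP
  change _ * x ^ n = aeval x (reflect n Q) at hQ
  obtain ⟨h₁, h₂⟩ := hK.eq_zero_of_add_mul_eq_zero hF w hwx hwy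
    (p := p * X ^ (n + g + 1) + reflect n P * X ^ (g - 1 + (g + 1)))
    (q := q * X ^ (n + g + 1) + reflect n Q * X ^ (g - 1)) (by
      simp only [map_add, map_mul, aeval_X_pow, ← hP, ← hQ]
      rw [hpq] at hPQ
      have hs₁ : x⁻¹ ^ (g - 1) * x ^ (g - 1) = 1 := by
        rw [← mul_pow, inv_mul_cancel₀ hx0, one_pow]
      have hs₂ : x⁻¹ ^ (g + 1) * x ^ (g + 1) = 1 := by
        rw [← mul_pow, inv_mul_cancel₀ hx0, one_pow]
      generalize x⁻¹ ^ (g - 1) = s₁ at *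
      generalize x⁻¹ ^ (g + 1) = s₂ at *
      rw [add_assoc n, pow_add, pow_add]
      linear_combination (-x ^ n * x ^ (g - 1) * x ^ (g + 1)) * hPQ -
        x ^ n * x ^ (g + 1) * (aeval x p + aeval x q * y) * hs₁ -
        aeval x⁻¹ Q * y * x ^ n * x ^ (g - 1) * hs₂)
  have hq : q = 0 := by
    by_contra hq
    have := congrArg natDegree (eq_neg_of_add_eq_zero_left h₂)
    rw [natDegree_neg, natDegree_mul_X_pow _ hq] at this
    have := natDegree_mul_le (p := reflect n Q) (q := X ^ (g - 1))
    rw [natDegree_X_pow] at this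
    omega
  refine ⟨p, ?_, by rw [hpq, hq]; simp⟩
  by_cases hp : p = 0
  · simp [hp]
  have := congrArg natDegree (eq_neg_of_add_eq_zero_left h₁)
  rw [natDegree_neg, natDegree_mul_X_pow _ hp] at this
  have := natDegree_mul_le (p := reflect n P) (q := X ^ (g - 1 + (g + 1)))
  rw [natDegree_X_pow] at this
  omega

theorem exists_represents [CharZero k] {g : ℕ} (hg : 2 ≤ g)
    (hK : IsHyperellipticFunctionField k F K x y) (hF : Squarefree F)
    (hdF : F.natDegree = 2 * g + 1 ∨ F.natDegree = 2 * g + 2) (w : K ≃ₐ[k] K) (hwx : w x = x)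
    (hwy : w y = -y) (u : K ≃ₐ[k] K) : ∃ M e, Represents g x y x y u M e := by
  have hy0 := hK.y_ne_zero hF
  obtain ⟨n, rfl⟩ := Nat.exists_eq_add_of_le' hg
  obtain ⟨D, hD⟩ := hK.exists_derivation y
  set h := u (D (u.symm x)) / y with hh
  have hconj : Derivation.conj u D = h • D := hK.derivation_ext hF (by
    change u (D (u.symm x)) = h * D x
    rw [hD, hh]
    field_simp)
  have hu : ∀ b, u (D b) = h * D (u b) := fun b ↦ by
    have := DFunLike.congr_fun hconj (u b)
    change u (D (u.symm (u b))) = h * D (u b) at this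
    rwa [u.symm_apply_apply] at this
  have huy : u y = h * D (u x) := by rw [← hu, hD]
  have huy0 : u y ≠ 0 := by simpa using hy0
  have hh0 : h ≠ 0 := left_ne_zero_of_mul (huy ▸ huy0)
  have hux : Transcendental k (u x) := fun h ↦
    hK.transcendental_x ((isAlgebraic_algHom_iff (u : K →ₐ[k] K) u.injective).1 h)
  obtain ⟨a, b, c, ha, hb, hB, hc, hzb, hf⟩ := exists_linear_fractional hK.transcendental_x hux
    (inv_ne_zero hh0) (n := n) fun i hi ↦ by
      refine exists_polynomial_of_forall_mem_regularAt (g := n + 2) (by omega) hK hF hdF w hwx hwy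
        hD fun O hO ↦ ?_
      rw [← map_pow, ← div_eq_mul_inv]
      refine map_div_mem_regularAt D O u hh0 hu ?_
      refine hK.pow_mem_regularAt (g := n + 2) (by omega) hF hdF hD (fun c ↦ ?_) hi
      change u (algebraMap k K c) ∈ O
      rw [u.commutes]
      exact hO c
  obtain ⟨a₁, a₀, rfl⟩ := exists_eq_X_add_C_of_natDegree_le_one ha
  obtain ⟨b₁, b₀, rfl⟩ := exists_eq_X_add_C_of_natDegree_le_one hb
  simp only [map_add, map_mul, aeval_C, aeval_X] at hzb hB hf
  have hDz : D (u x) * (algebraMap k K b₁ * x + algebraMap k K b₀) ^ 2 =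
      algebraMap k K (a₁ * b₀ - a₀ * b₁) * y := by
    have := congrArg D hzb
    simp only [D.leibniz, map_add, D.map_algebraMap, hD, smul_eq_mul] at this
    simp only [map_sub, map_mul]
    linear_combination (algebraMap k K b₁ * x + algebraMap k K b₀) * this -
      algebraMap k K b₁ * y * hzb
  have hdet : a₁ * b₀ - a₀ * b₁ ≠ 0 := by
    intro h0
    rw [h0, map_zero, zero_mul] at hDz
    exact mul_ne_zero (right_ne_zero_of_mul (huy ▸ huy0)) (pow_ne_zero 2 hB) hDz
  refine ⟨Matrix.GeneralLinearGroup.mkOfDetNeZero !![a₁, a₀; b₁, b₀]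
    (by rwa [Matrix.det_fin_two_of]), Units.mk0 ((a₁ * b₀ - a₀ * b₁) / c) (div_ne_zero hdet hc),
    ?_, ?_⟩
  · simp only [Matrix.GeneralLinearGroup.mkOfDetNeZero, Matrix.GeneralLinearGroup.mk']
    exact eq_div_of_mul_eq hB hzb
  · change u y = algebraMap k K ((a₁ * b₀ - a₀ * b₁) / c) * y /
      (algebraMap k K b₁ * x + algebraMap k K b₀) ^ (n + 2 + 1)
    have hc' : algebraMap k K c ≠ 0 := by simpa using hc
    generalize algebraMap k K b₁ * x + algebraMap k K b₀ = B at hB hDz hf ⊢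
    rw [huy, ← inv_inv h, hf, map_div₀, div_mul_eq_mul_div, ← hDz]
    field_simp
    ring

end IsHyperellipticFunctionField

end

section Represents

variable {k K : Type*} [Field k] [Field K] [Algebra k K] {x y : K} {g : ℕ}

theorem Represents.denominator_ne_zero {M : GL (Fin 2) k} (hx : Transcendental k x) :
    algebraMap k K (M.val 1 0) * x + algebraMap k K (M.val 1 1) ≠ 0 := by
  intro h
  have h' : aeval x (C (M.val 1 0) * X + C (M.val 1 1)) = 0 := by simpa using h
  have h0 := transcendental_iff.1 hx _ h'
  have h₁ : M.val 1 0 = 0 := by simpa using congrArg (coeff · 1) h0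
  have h₂ : M.val 1 1 = 0 := by simpa using congrArg (coeff · 0) h0
  have hdet := M.det_ne_zero
  rw [Matrix.det_fin_two, h₁, h₂] at hdet
  simp at hdet

theorem Represents.map_linear {u : K ≃ₐ[k] K} {N : GL (Fin 2) k} {e : kˣ}
    (hx : Transcendental k x) (hu : Represents g x y x y u N e) (M : GL (Fin 2) k) (i : Fin 2) :
    algebraMap k K (M.val i 0) * u x + algebraMap k K (M.val i 1) =
      (algebraMap k K ((M * N).val i 0) * x + algebraMap k K ((M * N).val i 1)) /
        (algebraMap k K (N.val 1 0) * x + algebraMap k K (N.val 1 1)) := by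
  have hN := Represents.denominator_ne_zero (K := K) (M := N) hx
  rw [hu.1, eq_div_iff hN]
  simp only [Units.val_mul, Matrix.mul_apply, Fin.sum_univ_two, map_add, map_mul]
  rw [add_mul, mul_assoc, div_mul_cancel₀ _ hN]
  ring

theorem Represents.trans (hx : Transcendental k x) {u v : K ≃ₐ[k] K} {M N : GL (Fin 2) k}
    {e f : kˣ} (hv : Represents g x y x y v M e) (hu : Represents g x y x y u N f) :
    Represents g x y x y (v.trans u) (M * N) (e * f) := by
  have hN := Represents.denominator_ne_zero (K := K) (M := N) hx
  have hMN := Represents.denominator_ne_zero (K := K) (M := M * N) hx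
  constructor
  · rw [AlgEquiv.trans_apply, hv.1, map_div₀, map_add, map_add, map_mul, map_mul]
    simp only [AlgEquiv.commutes]
    rw [hu.map_linear hx, hu.map_linear hx, div_div_div_cancel_right₀ hN]
  · rw [AlgEquiv.trans_apply, hv.2, map_div₀, map_pow, map_add, map_mul, map_mul]
    simp only [AlgEquiv.commutes]
    rw [hu.map_linear hx, hu.2, Units.val_mul e f, map_mul, div_pow, ← mul_div_assoc,
      div_div_div_cancel_right₀ (pow_ne_zero _ hN), mul_assoc]

theorem Represents.smul {u : K ≃ₐ[k] K} {M : GL (Fin 2) k} {e : kˣ}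
    (h : Represents g x y x y u M e) (l : kˣ) :
    Represents g x y x y u (Matrix.GeneralLinearGroup.scalar (Fin 2) l * M) (l ^ (g + 1) * e) := by
  have hl : algebraMap k K l ≠ 0 := by simp
  have hM : ∀ i j, (Matrix.GeneralLinearGroup.scalar (Fin 2) l * M).val i j = l * M.val i j := by
    intro i j
    simp [Matrix.GeneralLinearGroup.scalar]
  constructor
  · rw [h.1]
    simp only [hM, map_mul, mul_assoc, ← mul_add]
    rw [mul_div_mul_left _ _ hl]
  · rw [h.2]
    simp only [hM, map_mul, mul_assoc, ← mul_add, Units.val_mul, Units.val_pow_eq_pow_val, map_pow,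
      mul_pow]
    rw [mul_div_mul_left _ _ (pow_ne_zero _ hl)]

theorem Represents.exists_eq_scalar_mul (hx : Transcendental k x) (hy : y ≠ 0) {u : K ≃ₐ[k] K}
    {M M' : GL (Fin 2) k} {e e' : kˣ} (h : Represents g x y x y u M e)
    (h' : Represents g x y x y u M' e') :
    ∃ l : kˣ, M' = Matrix.GeneralLinearGroup.scalar (Fin 2) l * M ∧ e' = l ^ (g + 1) * e := by
  have hz : Transcendental k (u x) := fun h ↦
    hx ((isAlgebraic_algHom_iff (u : K →ₐ[k] K) u.injective).1 h)
  obtain ⟨N, rfl⟩ : ∃ N, M' = N * M := ⟨M' * M⁻¹, by simp⟩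
  have hM := Represents.denominator_ne_zero (K := K) (M := M) hx
  have hN := Represents.denominator_ne_zero (K := K) (M := N) hz
  have hux : u x = (algebraMap k K (N.val 0 0) * u x + algebraMap k K (N.val 0 1)) /
      (algebraMap k K (N.val 1 0) * u x + algebraMap k K (N.val 1 1)) := by
    rw [h.map_linear hx, h.map_linear hx, div_div_div_cancel_right₀ hM]
    exact h'.1
  rw [eq_div_iff hN] at hux
  have h0 := transcendental_iff.1 hz
    (C (N.val 1 0) * X ^ 2 + C (N.val 1 1 - N.val 0 0) * X - C (N.val 0 1)) (by
      simp only [map_add, map_sub, map_mul, map_pow, aeval_X, aeval_C]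
      linear_combination hux)
  have h₁₀ : N.val 1 0 = 0 := by simpa [coeff_X, coeff_C] using congrArg (coeff · 2) h0
  have h₀₁ : N.val 0 1 = 0 := by simpa using congrArg (coeff · 0) h0
  have h₁₁ : N.val 1 1 = N.val 0 0 := by
    simpa [coeff_X_pow, coeff_C, sub_eq_zero] using congrArg (coeff · 1) h0
  have hl : N.val 0 0 ≠ 0 := by
    intro hl
    have hdet := N.det_ne_zero
    rw [Matrix.det_fin_two, h₁₀, hl] at hdet
    simp at hdet
  have hNl : N = Matrix.GeneralLinearGroup.scalar (Fin 2) (Units.mk0 _ hl) := by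
    ext i j
    fin_cases i <;> fin_cases j <;> simp [Matrix.GeneralLinearGroup.scalar, h₁₀, h₀₁, h₁₁]
  refine ⟨Units.mk0 _ hl, by rw [← hNl], ?_⟩
  have hsmul := h.smul (Units.mk0 _ hl)
  rw [← hNl] at hsmul
  have hy' := h'.2.symm.trans hsmul.2
  rw [div_left_inj' (pow_ne_zero _ (Represents.denominator_ne_zero hx)), mul_left_inj' hy] at hy'
  exact Units.ext ((algebraMap k K).injective hy')

end Represents

/-- For even `g ≥ 2`: every `k`-algebra automorphism `u` of the hyperelliptic function
field `K = k(x)(y)`, `y² = F(x)`, is represented by a unique pair `(M, e)` with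
`e = (det M)^{g/2}`; the assignment `u ↦ M_u` is injective, satisfies
`M_{u∘v} = M_v · M_u`, and sends the hyperelliptic involution `w` to `−Id`. -/
theorem stmt_6 {k : Type*} [Field k] [CharZero k] (g : ℕ) (hg : 2 ≤ g)
    (hgeven : Even g)
    (F : k[X]) (hF : Squarefree F)
    (hdF : F.natDegree = 2 * g + 1 ∨ F.natDegree = 2 * g + 2)
    {K : Type*} [Field K] [Algebra k K] (x y : K)
    (hK : IsHyperellipticFunctionField k F K x y)
    (w : K ≃ₐ[k] K) (hwx : w x = x) (hwy : w y = -y) :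
    ∃ Mfun : (K ≃ₐ[k] K) → GL (Fin 2) k,
      (∀ u : K ≃ₐ[k] K,
        Represents g x y x y u (Mfun u)
          (Matrix.GeneralLinearGroup.det (Mfun u) ^ (g / 2))) ∧
      (∀ (u : K ≃ₐ[k] K) (M : GL (Fin 2) k) (e : kˣ),
        Represents g x y x y u M e →
          e = Matrix.GeneralLinearGroup.det M ^ (g / 2) → M = Mfun u) ∧
      Function.Injective Mfun ∧
      (∀ u v : K ≃ₐ[k] K, Mfun (v.trans u) = Mfun v * Mfun u) ∧
      Mfun w = -1 := by
  have hx := hK.transcendental_x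
  have hdet : ∀ (l : kˣ) (M : GL (Fin 2) k),
      Matrix.GeneralLinearGroup.det (Matrix.GeneralLinearGroup.scalar (Fin 2) l * M) ^ (g / 2) =
        l ^ g * Matrix.GeneralLinearGroup.det M ^ (g / 2) := fun l M ↦ by
    have : Matrix.GeneralLinearGroup.det (Matrix.GeneralLinearGroup.scalar (Fin 2) l) = l ^ 2 := by
      ext
      simp [Matrix.GeneralLinearGroup.scalar]
    rw [map_mul, this, mul_pow, ← pow_mul, Nat.mul_div_cancel' hgeven.two_dvd]
  have hex : ∀ u : K ≃ₐ[k] K, ∃ M,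
      Represents g x y x y u M (Matrix.GeneralLinearGroup.det M ^ (g / 2)) := fun u ↦ by
    obtain ⟨M, e, h⟩ := hK.exists_represents hg hF hdF w hwx hwy u
    refine ⟨Matrix.GeneralLinearGroup.scalar (Fin 2)
      (Matrix.GeneralLinearGroup.det M ^ (g / 2) / e) * M, ?_⟩
    convert h.smul (Matrix.GeneralLinearGroup.det M ^ (g / 2) / e) using 1
    rw [hdet, pow_succ, mul_assoc, div_mul_cancel]
  choose Mfun hMfun using hex
  have huniq : ∀ (u : K ≃ₐ[k] K) (M : GL (Fin 2) k) (e : kˣ), Represents g x y x y u M e →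
      e = Matrix.GeneralLinearGroup.det M ^ (g / 2) → M = Mfun u := fun u M e h he ↦ by
    obtain ⟨l, hl, hle⟩ := (hMfun u).exists_eq_scalar_mul hx (hK.y_ne_zero hF) h
    rw [he, hl, hdet, mul_left_inj, pow_succ, left_eq_mul] at hle
    rw [hl, hle, map_one, one_mul]
  refine ⟨Mfun, hMfun, huniq, fun u v huv ↦ ?_, fun u v ↦ ?_, ?_⟩
  · have hu := hMfun u
    rw [huv] at hu
    exact hK.algEquiv_ext (hu.1.trans (hMfun v).1.symm) (hu.2.trans (hMfun v).2.symm)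
  · refine (huniq _ _ _ ((hMfun v).trans hx (hMfun u)) ?_).symm
    rw [map_mul, mul_pow]
  · refine (huniq w (-1) 1 ⟨?_, ?_⟩ ?_).symm
    · simp [hwx]
    · simp [hwy, hgeven.add_one.neg_one_pow, div_neg]
    · have : Matrix.GeneralLinearGroup.det (-1 : GL (Fin 2) k) = 1 := by
        ext
        simp [Matrix.det_fin_two]
      rw [this, one_pow]
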